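/- arXiv:1907.07740 — 3 statements merged into one kernel-verified Lean document; each statement's English description precedes it below -/
import Mathlib

section
/- Let g be a real semisimple Lie algebra and σ, τ commuting involutive automorphisms with dim(g^{−τ} ∩ g^{−σ}) = 1, spanned by x₀. Then in the fixed-point algebra g^{στ} = (g^τ ∩ g^σ) ⊕ ℝ·x₀, the line ℝ·x₀ is an ideal; since g^{στ} is reductive in g, x₀ is central in g^{στ} and g^τ ∩ g^σ is an ideal of g^{στ}. -/
/-- Let `g` be real semisimple, `σ, τ` commuting involutive
automorphisms with `g^{-τ} ∩ g^{-σ} = ℝ·x₀` one-dimensional. Then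
`g^{στ} = (g^τ ∩ g^σ) ⊕ ℝ·x₀`, the line `ℝ·x₀` is an ideal of `g^{στ}`,
`x₀` is central in `g^{στ}`, and `g^τ ∩ g^σ` is an ideal of `g^{στ}`. -/
theorem stmt_13 {L : Type*} [LieRing L] [LieAlgebra ℝ L] [FiniteDimensional ℝ L]
    (τ σ : L →ₗ⁅ℝ⁆ L)
    (hτ : ∀ z : L, τ (τ z) = z) (hσ : ∀ z : L, σ (σ z) = z)
    (hcomm : ∀ z : L, τ (σ z) = σ (τ z))
    (hss : LieAlgebra.radical ℝ L = ⊥)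
    (x₀ : L) (hx₀ : x₀ ≠ 0)
    (hspan : {x : L | τ x = -x ∧ σ x = -x} = (Submodule.span ℝ {x₀} : Submodule ℝ L)) :
    -- decomposition `g^{στ} = (g^τ ∩ g^σ) ⊕ ℝ·x₀`
    (∀ z : L, σ (τ z) = z → ∃ (w : L) (t : ℝ), τ w = w ∧ σ w = w ∧ z = w + t • x₀) ∧
    -- `ℝ·x₀` is an ideal of `g^{στ}`
    (∀ z : L, σ (τ z) = z → ⁅z, x₀⁆ ∈ (Submodule.span ℝ {x₀} : Submodule ℝ L)) ∧
    -- `x₀` is central in `g^{στ}`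
    (∀ z : L, σ (τ z) = z → ⁅z, x₀⁆ = 0) ∧
    -- `g^τ ∩ g^σ` is an ideal of `g^{στ}`
    (∀ z w : L, σ (τ z) = z → τ w = w → σ w = w → τ ⁅z, w⁆ = ⁅z, w⁆ ∧ σ ⁅z, w⁆ = ⁅z, w⁆) := by
  have hx : τ x₀ = -x₀ ∧ σ x₀ = -x₀ := by
    have : x₀ ∈ {x : L | τ x = -x ∧ σ x = -x} := by
      rw [hspan]; exact Submodule.mem_span_singleton_self x₀
    exact this
  obtain ⟨hxτ, hxσ⟩ := hx
  have hmem : ∀ x : L, τ x = -x → σ x = -x → ∃ t : ℝ, t • x₀ = x := by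
    intro x h1 h2
    have : x ∈ {x : L | τ x = -x ∧ σ x = -x} := ⟨h1, h2⟩
    rw [hspan] at this
    exact Submodule.mem_span_singleton.mp this
  have hστ : ∀ z : L, σ (τ z) = z → σ z = τ z := by
    intro z hz
    have := congrArg σ hz
    rw [hσ] at this
    exact this.symm
  have hdec : ∀ z : L, σ (τ z) = z →
      ∃ (w : L) (t : ℝ), τ w = w ∧ σ w = w ∧ z = w + t • x₀ := by
    intro z hz
    have h1 := hστ z hz
    obtain ⟨t, ht⟩ := hmem ((1/2 : ℝ) • (z - τ z))
      (by simp only [map_smul, map_sub, hτ]; module)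
      (by simp only [map_smul, map_sub, hz, h1]; module)
    refine ⟨(1/2 : ℝ) • (z + τ z), t, ?_, ?_, ?_⟩
    · simp only [map_smul, map_add, hτ]; module
    · simp only [map_smul, map_add, hz, h1]; module
    · rw [ht]; module
  -- the Killing form and its invariance
  have hrad : LieAlgebra.HasTrivialRadical ℝ L := ⟨hss⟩
  have hinv : ∀ (φ : L →ₗ⁅ℝ⁆ L), (∀ z, φ (φ z) = z) → ∀ x y,
      killingForm ℝ L (φ x) (φ y) = killingForm ℝ L x y := by
    intro φ hφ x y
    let e : L ≃ₗ⁅ℝ⁆ L := { φ with invFun := φ, left_inv := hφ, right_inv := hφ }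
    exact LieAlgebra.killingForm_of_equiv_apply e x y
  have hneg : ∀ (φ : L →ₗ⁅ℝ⁆ L), (∀ z, φ (φ z) = z) → φ x₀ = -x₀ → ∀ y,
      killingForm ℝ L x₀ (φ y) = - killingForm ℝ L x₀ y := by
    intro φ hφ hx y
    have := hinv φ hφ x₀ y
    rw [hx, map_neg, LinearMap.neg_apply] at this
    linarith
  have hxx : killingForm ℝ L x₀ x₀ ≠ 0 := by
    intro h0
    apply hx₀
    have hker : x₀ ∈ LinearMap.ker (killingForm ℝ L) := by
      rw [LinearMap.mem_ker]
      ext y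
      obtain ⟨t, ht⟩ := hmem (y - τ y - σ y + σ (τ y))
        (by simp only [map_sub, map_add, hτ, hcomm]; abel)
        (by simp only [map_sub, map_add, hσ]; abel)
      have h1 := congrArg (killingForm ℝ L x₀) ht
      simp only [map_smul, map_sub, map_add, hneg τ hτ hxτ, hneg σ hσ hxσ, h0, smul_zero] at h1
      simp only [LinearMap.zero_apply]
      linarith
    rwa [LieAlgebra.IsKilling.ker_killingForm_eq_bot, Submodule.mem_bot] at hker
  have hfix : ∀ w : L, τ w = w → σ w = w → ⁅w, x₀⁆ = 0 := by
    intro w h1 h2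
    obtain ⟨c, hc⟩ := hmem ⁅w, x₀⁆ (by rw [LieHom.map_lie, h1, hxτ, lie_neg])
      (by rw [LieHom.map_lie, h2, hxσ, lie_neg])
    have h3 : killingForm ℝ L ⁅w, x₀⁆ x₀ = killingForm ℝ L w ⁅x₀, x₀⁆ :=
      LieModule.traceForm_apply_lie_apply ℝ L L w x₀ x₀
    rw [lie_self, map_zero, ← hc, map_smul, LinearMap.smul_apply, smul_eq_mul] at h3
    rcases mul_eq_zero.mp h3 with h | h
    · rw [← hc, h, zero_smul]
    · exact absurd h hxx
  have hcent : ∀ z : L, σ (τ z) = z → ⁅z, x₀⁆ = 0 := by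
    intro z hz
    obtain ⟨w, t, h1, h2, rfl⟩ := hdec z hz
    rw [add_lie, smul_lie, lie_self, smul_zero, add_zero, hfix w h1 h2]
  refine ⟨hdec, ?_, hcent, ?_⟩
  · intro z hz
    rw [hcent z hz]
    exact Submodule.zero_mem _
  · intro z w hz h1 h2
    obtain ⟨v, t, h3, h4, rfl⟩ := hdec z hz
    have h5 : ⁅x₀, w⁆ = 0 := by rw [← lie_skew, hfix w h1 h2, neg_zero]
    rw [add_lie, smul_lie, h5, smul_zero, add_zero, LieHom.map_lie, LieHom.map_lie, h1, h2, h3, h4]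
    exact ⟨rfl, rfl⟩
end

section
/- Let g be a real semisimple Lie algebra, σ, τ commuting involutive automorphisms of g, and suppose dim(g^{−τ} ∩ g^{−σ}) = 1, spanned by x₀. Then the element x₀ is ad-semisimple (not nilpotent), and ad x₀ is either diagonalizable over ℝ (x₀ hyperbolic) or semisimple with purely imaginary spectrum (x₀ elliptic). -/
open TensorProduct

namespace Stmt14Aux

open Module.End

lemma exists_scale {V : Type*} [AddCommGroup V] [Module ℂ V] [FiniteDimensional ℂ V]
    (T : Module.End ℂ V) (f : ℂ → ℂ) :
    ∃ S : Module.End ℂ V, ∀ μ, ∀ v ∈ T.maxGenEigenspace μ, S v = f μ • v := by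
  classical
  have hint : DirectSum.IsInternal (fun μ => T.maxGenEigenspace μ) :=
    (DirectSum.isInternal_submodule_iff_iSupIndep_and_iSup_eq_top _).2
      ⟨T.independent_maxGenEigenspace, T.iSup_maxGenEigenspace_eq_top⟩
  let e := LinearEquiv.ofBijective
    (DirectSum.coeLinearMap (fun μ => T.maxGenEigenspace μ)) hint
  refine ⟨(DirectSum.toModule ℂ ℂ V (fun μ => f μ • (T.maxGenEigenspace μ).subtype)) ∘ₗ
    e.symm.toLinearMap, fun μ v hv => ?_⟩
  have : e.symm v = DirectSum.lof ℂ ℂ (fun μ => T.maxGenEigenspace μ) μ ⟨v, hv⟩ := by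
    rw [LinearEquiv.symm_apply_eq]
    exact (DirectSum.coeLinearMap_lof (fun μ => T.maxGenEigenspace μ) μ ⟨v, hv⟩).symm
  simp [this]

lemma ext_gen {V W : Type*} [AddCommGroup V] [Module ℂ V] [FiniteDimensional ℂ V]
    [AddCommGroup W] [Module ℂ W]
    (T : Module.End ℂ V) (A B : V →ₗ[ℂ] W)
    (h : ∀ μ, ∀ v ∈ T.maxGenEigenspace μ, A v = B v) : A = B := by
  have : (⊤ : Submodule ℂ V) ≤ LinearMap.eqLocus A B := by
    rw [← T.iSup_maxGenEigenspace_eq_top]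
    exact iSup_le fun μ v hv => h μ v hv
  ext v
  exact this (Submodule.mem_top : v ∈ ⊤)

section
variable {G : Type*} [LieRing G] [LieAlgebra ℂ G]

lemma map_gen (τ : G →ₗ⁅ℂ⁆ G) {x : G} (hx : τ x = -x) {μ : ℂ} {v : G}
    (hv : v ∈ (LieAlgebra.ad ℂ G x).maxGenEigenspace μ) :
    τ v ∈ (LieAlgebra.ad ℂ G x).maxGenEigenspace (-μ) := by
  rw [mem_maxGenEigenspace] at hv ⊢
  obtain ⟨k, hk⟩ := hv
  refine ⟨k, ?_⟩
  have key : ∀ (k : ℕ) (w : G), ((LieAlgebra.ad ℂ G x - (-μ) • 1) ^ k) (τ w) =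
      (-1 : ℂ) ^ k • τ (((LieAlgebra.ad ℂ G x - μ • 1) ^ k) w) := by
    intro k
    induction k with
    | zero => intro w; simp
    | succ k ih =>
      intro w
      have h1 : (LieAlgebra.ad ℂ G x - (-μ) • (1 : Module.End ℂ G)) (τ w) =
          τ (- ((LieAlgebra.ad ℂ G x - μ • (1 : Module.End ℂ G)) w)) := by
        simp only [LinearMap.sub_apply, LieAlgebra.ad_apply, LinearMap.smul_apply,
          Module.End.one_apply, map_neg, map_sub, LieHom.map_lie, hx, map_smul, neg_lie]
        rw [neg_smul]
        abel
      rw [pow_succ, Module.End.mul_apply, h1, ih, pow_succ (_ - _) k, Module.End.mul_apply,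
        pow_succ, map_neg, map_neg, mul_neg_one, neg_smul, smul_neg]
  rw [key, hk]; simp

lemma key [FiniteDimensional ℂ G] [LieAlgebra.IsKilling ℂ G]
    (τ σ : G →ₗ⁅ℂ⁆ G) (hτ : ∀ z, τ (τ z) = z) (hσ : ∀ z, σ (σ z) = z)
    (x : G) (hτx : τ x = -x) (hσx : σ x = -x)
    (hq : ∀ y, τ y = -y → σ y = -y → ∃ c : ℂ, y = c • x) (f : ℂ →+ ℂ) :
    ∃ c : ℂ, ∀ μ, ∀ v ∈ (LieAlgebra.ad ℂ G x).maxGenEigenspace μ,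
      f μ • v = c • ⁅x, v⁆ := by
  obtain ⟨S, hS⟩ := exists_scale (LieAlgebra.ad ℂ G x) f
  have hder : ∀ a b, S ⁅a, b⁆ = ⁅a, S b⁆ - ⁅b, S a⁆ := by
    have : (LieModule.toEnd ℂ G G : G →ₗ[ℂ] _).compr₂ S =
        (LieModule.toEnd ℂ G G : G →ₗ[ℂ] _).compl₂ S +
        (LieModule.toEnd ℂ G G : G →ₗ[ℂ] _) ∘ₗ S := by
      refine ext_gen (LieAlgebra.ad ℂ G x) _ _ fun μ a ha => ?_
      refine ext_gen (LieAlgebra.ad ℂ G x) _ _ fun ν b hb => ?_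
      have := hS _ _ (LieModule.lie_mem_maxGenEigenspace_toEnd (M := G) ha hb)
      simp [this, hS _ _ ha, hS _ _ hb, add_smul]
      abel
    intro a b
    have := LinearMap.congr_fun₂ this a b
    simp at this
    rw [this, ← lie_skew b (S a)]
    abel
  let D : LieDerivation ℂ G G := ⟨S, hder⟩
  obtain ⟨y, hy⟩ := LieDerivation.IsKilling.exists_eq_ad D
  have hy' : ∀ z, ⁅y, z⁆ = S z := fun z => by
    have := DFunLike.congr_fun hy z
    simp at this
    exact this
  have hflip : ∀ τ : G →ₗ⁅ℂ⁆ G, (∀ z, τ (τ z) = z) → τ x = -x → τ y = -y := by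
    intro τ hτ hτx
    have h1 : (τ : G →ₗ[ℂ] G) ∘ₗ S = -(S ∘ₗ (τ : G →ₗ[ℂ] G)) := by
      refine ext_gen (LieAlgebra.ad ℂ G x) _ _ fun μ a ha => ?_
      have := hS _ _ (map_gen τ hτx ha)
      simp [this, hS _ _ ha]
    rw [← add_eq_zero_iff_eq_neg, ← LieDerivation.IsKilling.ad_apply_eq_zero_iff ℂ G]
    ext z
    have h2 := LinearMap.congr_fun h1 (τ z)
    simp [hτ] at h2
    have h3 : ⁅τ y, z⁆ = τ ⁅y, τ z⁆ := by rw [LieHom.map_lie, hτ]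
    simp [h3, hy', h2]
  obtain ⟨c, hc⟩ := hq y (hflip τ hτ hτx) (hflip σ hσ hσx)
  refine ⟨c, fun μ v hv => ?_⟩
  rw [← hS _ _ hv, ← hy', hc, smul_lie]
end

lemma isNilpotent_of_eig {V : Type*} [AddCommGroup V] [Module ℂ V] [FiniteDimensional ℂ V]
    (T : Module.End ℂ V) (h : ∀ μ, T.HasEigenvalue μ → μ = 0) : IsNilpotent T := by
  have h0 : T.maxGenEigenspace 0 = ⊤ := by
    rw [eq_top_iff, ← T.iSup_maxGenEigenspace_eq_top]
    refine iSup_le fun μ => ?_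
    by_cases hμ : T.HasEigenvalue μ
    · rw [h μ hμ]
    · have : T.maxGenEigenspace μ = ⊥ := by
        by_contra hne
        have h1 : T.HasUnifEigenvalue μ ⊤ := hne
        exact hμ (h1.lt zero_lt_one)
      simp [this]
  rw [maxGenEigenspace_eq_genEigenspace_finrank] at h0
  refine ⟨Module.finrank ℂ V, ?_⟩
  ext v
  have : v ∈ T.genEigenspace 0 (Module.finrank ℂ V) := by rw [h0]; trivial
  rw [mem_genEigenspace_nat] at this
  simpa using this

lemma isSemisimple_of_gen {V : Type*} [AddCommGroup V] [Module ℂ V] [FiniteDimensional ℂ V]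
    (T : Module.End ℂ V) (h : ∀ μ, ∀ v ∈ T.maxGenEigenspace μ, T v = μ • v) :
    T.IsSemisimple := by
  classical
  have hfin : {μ | T.HasEigenvalue μ}.Finite := T.finite_hasEigenvalue
  let p : Polynomial ℂ := ∏ μ ∈ hfin.toFinset, (Polynomial.X - Polynomial.C μ)
  have hsq : Squarefree p := by
    apply Polynomial.Separable.squarefree
    exact Polynomial.separable_prod_X_sub_C_iff'.2 (fun _ _ _ _ h => h)
  refine isSemisimple_of_squarefree_aeval_eq_zero hsq ?_
  refine ext_gen T _ _ fun μ v hv => ?_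
  by_cases hv0 : v = 0
  · simp [hv0]
  have hev : T.HasEigenvector μ v := ⟨mem_eigenspace_iff.2 (h μ v hv), hv0⟩
  rw [aeval_apply_of_hasEigenvector hev]
  have : p.eval μ = 0 := by
    simp only [p, Polynomial.eval_prod]
    exact Finset.prod_eq_zero (i := μ)
      (by simpa using hasEigenvalue_of_hasEigenvector hev) (by simp)
  simp [this]

lemma conj_eig {V : Type*} [AddCommGroup V] [Module ℝ V] [FiniteDimensional ℝ V]
    (T : Module.End ℝ V) {μ : ℂ}
    (h : Module.End.HasEigenvalue (LinearMap.baseChange ℂ T) μ) :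
    Module.End.HasEigenvalue (LinearMap.baseChange ℂ T) (star μ) := by
  rw [hasEigenvalue_iff_isRoot_charpoly, LinearMap.charpoly_baseChange] at h ⊢
  rw [Polynomial.IsRoot.def, Polynomial.eval_map_algebraMap] at h ⊢
  have := Polynomial.aeval_conj T.charpoly μ
  rw [h] at this
  simpa using this

section
variable {L : Type*} [LieRing L] [LieAlgebra ℝ L]

lemma decomp (y : ℂ ⊗[ℝ] L) : ∃ a b : L, y = 1 ⊗ₜ a + Complex.I ⊗ₜ b := by
  induction y with
  | zero => exact ⟨0, 0, by simp⟩
  | tmul z v =>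
    refine ⟨z.re • v, z.im • v, ?_⟩
    rw [← TensorProduct.smul_tmul, ← TensorProduct.smul_tmul, ← TensorProduct.add_tmul]
    congr 1
    apply Complex.ext <;> simp
  | add y z hy hz =>
    obtain ⟨a, b, rfl⟩ := hy
    obtain ⟨c, d, rfl⟩ := hz
    refine ⟨a + c, b + d, ?_⟩
    simp only [TensorProduct.tmul_add]
    abel

lemma decomp_inj {a b c d : L}
    (h : (1 : ℂ) ⊗ₜ[ℝ] a + Complex.I ⊗ₜ[ℝ] b = 1 ⊗ₜ c + Complex.I ⊗ₜ d) : a = c ∧ b = d := by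
  constructor
  · simpa using congrArg (TensorProduct.lid ℝ L ∘ LinearMap.rTensor L Complex.reLm) h
  · simpa using congrArg (TensorProduct.lid ℝ L ∘ LinearMap.rTensor L Complex.imLm) h

lemma killing_bc [FiniteDimensional ℝ L] [LieAlgebra.IsKilling ℝ L] :
    LieAlgebra.IsKilling ℂ (ℂ ⊗[ℝ] L) := by
  constructor
  rw [eq_bot_iff]
  intro y hy
  rw [LieIdeal.mem_killingCompl] at hy
  obtain ⟨a, b, rfl⟩ := decomp y
  have h1 : ∀ z, killingForm ℝ L z a = 0 ∧ killingForm ℝ L z b = 0 := by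
    intro z
    have := hy (1 ⊗ₜ z) (by simp)
    rw [killingForm, LieModule.traceForm_baseChange] at this
    simp [LinearMap.BilinForm.baseChange_tmul] at this
    constructor
    · simpa using congrArg Complex.re this
    · simpa using congrArg Complex.im this
  have h2 := LieAlgebra.IsKilling.killingForm_nondegenerate ℝ L
  rw [h2.2 a fun z => (h1 z).1, h2.2 b fun z => (h1 z).2]
  simp

noncomputable def bcHom (τ : L →ₗ⁅ℝ⁆ L) : ℂ ⊗[ℝ] L →ₗ⁅ℂ⁆ ℂ ⊗[ℝ] L :=
  { LinearMap.baseChange ℂ (τ : L →ₗ[ℝ] L) with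
    map_lie' := by
      intro x y
      exact (LieAlgebra.ExtendScalars.map (AlgHom.id ℝ ℂ) τ).map_lie x y }

lemma bcHom_tmul (τ : L →ₗ⁅ℝ⁆ L) (z : ℂ) (v : L) : bcHom τ (z ⊗ₜ v) = z ⊗ₜ τ v := rfl

lemma bcHom_invol (τ : L →ₗ⁅ℝ⁆ L) (hτ : ∀ z, τ (τ z) = z) (y : ℂ ⊗[ℝ] L) :
    bcHom τ (bcHom τ y) = y := by
  obtain ⟨a, b, rfl⟩ := decomp y
  simp [bcHom_tmul, hτ]

lemma bcHom_neg (τ : L →ₗ⁅ℝ⁆ L) {a b : L}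
    (h : bcHom τ (1 ⊗ₜ a + Complex.I ⊗ₜ b) = -(1 ⊗ₜ a + Complex.I ⊗ₜ b)) :
    τ a = -a ∧ τ b = -b := by
  apply decomp_inj
  rw [map_add, bcHom_tmul, bcHom_tmul] at h
  rw [h]
  simp [TensorProduct.tmul_neg]
  abel

lemma killing_invol (τ : L →ₗ⁅ℝ⁆ L) (hτ : ∀ z, τ (τ z) = z) (x y : L) :
    killingForm ℝ L (τ x) (τ y) = killingForm ℝ L x y := by
  let e : L ≃ₗ⁅ℝ⁆ L := { τ with invFun := τ, left_inv := hτ, right_inv := hτ }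
  exact LieAlgebra.killingForm_of_equiv_apply e x y
end

lemma final {V : Type*} [AddCommGroup V] [Module ℂ V] [FiniteDimensional ℂ V]
    (T : Module.End ℂ V)
    (hkey' : ∀ f : ℂ →+ ℂ, ∃ c : ℂ, ∀ μ, ∀ v ∈ T.maxGenEigenspace μ, f μ • v = c • T v)
    (hnilC : ¬ IsNilpotent T)
    (hconj : ∀ μ, T.HasEigenvalue μ → T.HasEigenvalue (star μ)) :
    T.IsSemisimple ∧ ((∀ μ : ℂ, T.HasEigenvalue μ → μ.im = 0) ∨
      (∀ μ : ℂ, T.HasEigenvalue μ → μ.re = 0)) := by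
  have heig : ∀ f : ℂ →+ ℂ, ∃ c : ℂ, (∀ μ, ∀ v ∈ T.maxGenEigenspace μ,
      f μ • v = c • T v) ∧ ∀ μ, T.HasEigenvalue μ → f μ = c * μ := by
    intro f
    obtain ⟨c, hc⟩ := hkey' f
    refine ⟨c, hc, fun μ hμ => ?_⟩
    obtain ⟨v, hv⟩ := hμ.exists_hasEigenvector
    have h1 := hc μ v ((T.genEigenspace μ).monotone le_top hv.1)
    rw [hv.apply_eq_smul, smul_smul] at h1
    exact smul_left_injective ℂ hv.2 h1
  constructor
  · obtain ⟨c, hc, hce⟩ := heig (AddMonoidHom.id ℂ)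
    have hne : ∃ μ, T.HasEigenvalue μ ∧ μ ≠ 0 := by
      by_contra! hcon
      exact hnilC (isNilpotent_of_eig T hcon)
    obtain ⟨μ, hμ, hμ0⟩ := hne
    have hc1 : c = 1 := by
      have := hce μ hμ
      simp only [AddMonoidHom.id_apply] at this
      exact mul_right_cancel₀ hμ0 (by rw [← this, one_mul])
    subst hc1
    exact isSemisimple_of_gen T fun μ v hv => by simpa using (hc μ v hv).symm
  · obtain ⟨c, -, hce⟩ := heig (Complex.ofRealHom.toAddMonoidHom.comp Complex.reAddGroupHom)
    have hce' : ∀ μ, T.HasEigenvalue μ → (μ.re : ℂ) = c * μ := fun μ h => hce μ h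
    by_cases hc0 : c = 0
    · right
      intro μ hμ
      have := hce' μ hμ
      simpa [hc0] using this
    · left
      intro μ hμ
      have h1 := hce' μ hμ
      have h2 := hce' _ (hconj μ hμ)
      have h3 : star μ = μ := by
        apply mul_left_cancel₀ hc0
        rw [← h1, ← h2]; simp
      exact Complex.conj_eq_iff_im.1 h3

end Stmt14Aux

open Stmt14Aux

open TensorProduct

/-- Let `g` be real semisimple and `σ, τ` commuting involutive
automorphisms with `g^{-τ} ∩ g^{-σ} = ℝ·x₀` one-dimensional. Then `ad x₀` is
semisimple (in particular not nilpotent), and `x₀` is either hyperbolic (all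
eigenvalues of the complexified `ad x₀` are real) or elliptic (all eigenvalues
are purely imaginary). -/
theorem stmt_14 {L : Type*} [LieRing L] [LieAlgebra ℝ L] [FiniteDimensional ℝ L]
    (τ σ : L →ₗ⁅ℝ⁆ L)
    (hτ : ∀ z : L, τ (τ z) = z) (hσ : ∀ z : L, σ (σ z) = z)
    (hcomm : ∀ z : L, τ (σ z) = σ (τ z))
    (hss : LieAlgebra.radical ℝ L = ⊥)
    (x₀ : L) (hx₀ : x₀ ≠ 0)
    (hspan : {x : L | τ x = -x ∧ σ x = -x} = (Submodule.span ℝ {x₀} : Submodule ℝ L)) :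
    ¬ IsNilpotent (LieAlgebra.ad ℝ L x₀) ∧
    Module.End.IsSemisimple (LinearMap.baseChange ℂ ((LieAlgebra.ad ℝ L x₀ : L →ₗ[ℝ] L))) ∧
    ((∀ μ : ℂ, Module.End.HasEigenvalue
        (LinearMap.baseChange ℂ ((LieAlgebra.ad ℝ L x₀ : L →ₗ[ℝ] L))) μ → μ.im = 0) ∨
     (∀ μ : ℂ, Module.End.HasEigenvalue
        (LinearMap.baseChange ℂ ((LieAlgebra.ad ℝ L x₀ : L →ₗ[ℝ] L))) μ → μ.re = 0)) := by
  have : LieAlgebra.HasTrivialRadical ℝ L := ⟨hss⟩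
  have hq : ∀ x, τ x = -x → σ x = -x → ∃ r : ℝ, r • x₀ = x := by
    intro x h1 h2
    have : x ∈ {x : L | τ x = -x ∧ σ x = -x} := ⟨h1, h2⟩
    rw [hspan] at this
    exact Submodule.mem_span_singleton.1 this
  obtain ⟨hτx, hσx⟩ : τ x₀ = -x₀ ∧ σ x₀ = -x₀ := by
    have : x₀ ∈ {x : L | τ x = -x ∧ σ x = -x} := by
      rw [hspan]; exact Submodule.mem_span_singleton_self x₀
    exact this
  have hnil : ¬ IsNilpotent (LieAlgebra.ad ℝ L x₀) := by
    intro hn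
    have h0 : killingForm ℝ L x₀ x₀ = 0 := by
      rw [killingForm_apply_apply]
      have h2 : IsNilpotent ((LieAlgebra.ad ℝ L x₀) * (LieAlgebra.ad ℝ L x₀)) :=
        (Commute.refl _).isNilpotent_mul_left hn
      exact (LinearMap.isNilpotent_trace_of_isNilpotent h2).eq_zero
    refine hx₀ ((LieAlgebra.IsKilling.killingForm_nondegenerate ℝ L).1 x₀ fun z => ?_)
    obtain ⟨r, hr⟩ := hq (z - τ z - σ z + τ (σ z))
      (by simp only [map_add, map_sub, hτ]; abel)
      (by simp only [map_add, map_sub, hσ, hcomm]; abel)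
    have e1 : ∀ w, killingForm ℝ L x₀ (τ w) = - killingForm ℝ L x₀ w := fun w => by
      rw [← killing_invol τ hτ x₀ (τ w), hτ, hτx]; simp
    have e2 : ∀ w, killingForm ℝ L x₀ (σ w) = - killingForm ℝ L x₀ w := fun w => by
      rw [← killing_invol σ hσ x₀ (σ w), hσ, hσx]; simp
    have := congrArg (killingForm ℝ L x₀) hr
    simp only [map_add, map_sub, map_smul, e1, e2, h0, smul_zero] at this
    linarith
  refine ⟨hnil, ?_⟩
  have := killing_bc (L := L)
  have hT : LieAlgebra.ad ℂ (ℂ ⊗[ℝ] L) (1 ⊗ₜ x₀) =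
      LinearMap.baseChange ℂ ((LieAlgebra.ad ℝ L x₀ : L →ₗ[ℝ] L)) :=
    LieModule.toEnd_baseChange ℝ ℂ L L x₀
  have hkey := key (bcHom τ) (bcHom σ) (bcHom_invol τ hτ) (bcHom_invol σ hσ) (1 ⊗ₜ x₀)
    (by rw [bcHom_tmul, hτx, TensorProduct.tmul_neg])
    (by rw [bcHom_tmul, hσx, TensorProduct.tmul_neg])
    (by
      intro y h1 h2
      obtain ⟨a, b, rfl⟩ := decomp y
      obtain ⟨ha1, hb1⟩ := bcHom_neg τ h1
      obtain ⟨ha2, hb2⟩ := bcHom_neg σ h2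
      obtain ⟨r, rfl⟩ := hq a ha1 ha2
      obtain ⟨s, rfl⟩ := hq b hb1 hb2
      refine ⟨r + s * Complex.I, ?_⟩
      rw [← TensorProduct.smul_tmul, ← TensorProduct.smul_tmul, ← TensorProduct.add_tmul,
        TensorProduct.smul_tmul']
      congr 1
      simp)
  have hbr : ∀ v, ⁅(1 : ℂ) ⊗ₜ[ℝ] x₀, v⁆ =
      LinearMap.baseChange ℂ ((LieAlgebra.ad ℝ L x₀ : L →ₗ[ℝ] L)) v := fun v => by
    rw [← hT]; rfl
  have hkey' : ∀ f : ℂ →+ ℂ, ∃ c : ℂ, ∀ μ, ∀ v ∈ Module.End.maxGenEigenspace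
      (LinearMap.baseChange ℂ ((LieAlgebra.ad ℝ L x₀ : L →ₗ[ℝ] L))) μ,
      f μ • v = c • LinearMap.baseChange ℂ ((LieAlgebra.ad ℝ L x₀ : L →ₗ[ℝ] L)) v := by
    intro f
    obtain ⟨c, hc⟩ := hkey f
    rw [hT] at hc
    exact ⟨c, fun μ v hv => by rw [hc μ v hv, hbr]⟩
  have hnilC : ¬ IsNilpotent
      (LinearMap.baseChange ℂ ((LieAlgebra.ad ℝ L x₀ : L →ₗ[ℝ] L))) := by
    intro h
    apply hnil
    rw [← IsNilpotent.map_iff (f := Module.End.baseChangeHom ℝ ℂ L)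
      (LinearMap.baseChangeHom_injective ℝ L ℂ)]
    exact h
  clear hbr hkey
  have hconj := fun μ => conj_eig (LieAlgebra.ad ℝ L x₀ : L →ₗ[ℝ] L) (μ := μ)
  exact final _ hkey' hnilC hconj
end

section
/- Let g₁ be a simple real Lie algebra and σ₁ an involutive automorphism with one-dimensional fixed point algebra g₁^{σ₁} = ℝ·y₀. If y₀ is not elliptic (ad y₀ is not semisimple with purely imaginary spectrum), then g₁ ≅ sl₂(ℝ). -/
open TensorProduct

theorem rank_one_lemma {L : Type*} [LieRing L] [LieAlgebra ℝ L] [LieAlgebra.IsSimple ℝ L]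
    (σ : L →ₗ⁅ℝ⁆ L) (hσ : ∀ z : L, σ (σ z) = z)
    (y : L) (hy : y ≠ 0) (hfix : ∀ x : L, σ x = x ↔ ∃ c : ℝ, c • y = x) :
    ∃ (w : L) (c α : ℝ), c ≠ 0 ∧ α ≠ 0 ∧ σ w = -w ∧ ⁅w, ⁅y, w⁆⁆ = c • y ∧
      ⁅y, ⁅y, w⁆⁆ = α • w ∧ ∀ x : L, ∃ p q r : ℝ, x = p • y + q • w + r • ⁅y, w⁆ := by
  have hsy : σ y = y := (hfix y).2 ⟨1, one_smul _ _⟩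
  -- decomposition
  have hdec : ∀ z : L, ∃ (t : ℝ) (v : L), σ v = -v ∧ z = t • y + v := by
    intro z
    obtain ⟨t, ht⟩ := (hfix ((1/2 : ℝ) • (z + σ z))).1 (by
      rw [map_smul, map_add, hσ, add_comm])
    refine ⟨t, (1/2 : ℝ) • (z - σ z), ?_, ?_⟩
    · rw [map_smul, map_sub, hσ]; module
    · rw [ht]; module
  have hω : ∀ u v : L, σ u = -u → σ v = -v → ∃ c : ℝ, ⁅u, v⁆ = c • y := by
    intro u v hu hv
    obtain ⟨c, hc⟩ := (hfix ⁅u, v⁆).1 (by rw [LieHom.map_lie, hu, hv]; simp)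
    exact ⟨c, hc.symm⟩
  have hD : ∀ u : L, σ u = -u → σ ⁅y, u⁆ = -⁅y, u⁆ := by
    intro u hu
    rw [LieHom.map_lie, hu, hsy]; simp
  have hsimp : ∀ I : LieIdeal ℝ L, I = ⊥ ∨ I = ⊤ := LieAlgebra.IsSimple.eq_bot_or_eq_top
  have hself : ∀ x : L, σ x = x → σ x = -x → x = 0 := by
    intro x h1 h2
    rw [h1] at h2
    have h3 : (2:ℝ) • x = 0 := by rw [two_smul]; nth_rewrite 1 [h2]; simp
    exact (smul_eq_zero.1 h3).resolve_left (by norm_num)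
  -- nondegeneracy
  have hrad : ∀ u : L, σ u = -u → (∀ v, σ v = -v → ⁅u, v⁆ = 0) → u = 0 := by
    intro u hu huv
    let R : LieIdeal ℝ L :=
      { carrier := {x | σ x = -x ∧ ∀ v, σ v = -v → ⁅x, v⁆ = 0}
        add_mem' := by
          rintro a b ⟨ha, ha'⟩ ⟨hb, hb'⟩
          refine ⟨by rw [map_add, ha, hb]; abel, fun v hv => by
            rw [add_lie, ha' v hv, hb' v hv, add_zero]⟩
        zero_mem' := ⟨by simp, fun v _ => by simp⟩
        smul_mem' := by
          rintro c a ⟨ha, ha'⟩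
          refine ⟨by rw [map_smul, ha, smul_neg], fun v hv => by
            rw [smul_lie, ha' v hv, smul_zero]⟩
        lie_mem := by
          rintro z m ⟨hm, hm'⟩
          obtain ⟨t, v, hv, rfl⟩ := hdec z
          have h0 : ⁅v, m⁆ = 0 := by rw [← lie_skew, hm' v hv, neg_zero]
          have h1 : ⁅t • y + v, m⁆ = t • ⁅y, m⁆ := by rw [add_lie, h0, smul_lie, add_zero]
          change σ ⁅t • y + v, m⁆ = _ ∧ _
          rw [h1]
          refine ⟨by rw [map_smul, hD m hm, smul_neg], fun v' hv' => ?_⟩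
          rw [smul_lie, lie_lie, hm' _ (hD v' hv'), hm' v' hv']
          simp }
    rcases hsimp R with h | h
    · have : u ∈ R := ⟨hu, huv⟩
      rw [h] at this
      simpa using this
    · have : y ∈ R := by rw [h]; trivial
      exact absurd (hself y hsy this.1) hy
  have hDsk : ∀ u v : L, σ u = -u → σ v = -v → ⁅⁅y, u⁆, v⁆ = -⁅u, ⁅y, v⁆⁆ := by
    intro u v hu hv
    obtain ⟨c, hc⟩ := hω u v hu hv
    rw [lie_lie, hc]; simp
  have hJ : ∀ (u v w : L) (a b c : ℝ), ⁅u, v⁆ = a • y → ⁅v, w⁆ = b • y → ⁅w, u⁆ = c • y →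
      a • ⁅y, w⁆ + b • ⁅y, u⁆ + c • ⁅y, v⁆ = 0 := by
    intro u v w a b c h1 h2 h3
    rw [← smul_lie, ← smul_lie, ← smul_lie, ← h1, ← h2, ← h3]
    have := lie_jacobi w u v
    rw [← lie_skew w, ← lie_skew u ⁅v, w⁆, ← lie_skew v ⁅w, u⁆] at this
    rw [← neg_eq_zero, ← this]; abel
  -- injectivity
  have hinj : ∀ u : L, σ u = -u → ⁅y, u⁆ = 0 → u = 0 := by
    intro u hu hyu
    by_contra hu0
    have : ∃ v, σ v = -v ∧ ⁅u, v⁆ ≠ 0 := by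
      by_contra hcon
      push Not at hcon
      exact hu0 (hrad u hu hcon)
    obtain ⟨v, hv, huv⟩ := this
    obtain ⟨a, ha⟩ := hω u v hu hv
    have ha0 : a ≠ 0 := by rintro rfl; simp [huv] at ha
    obtain ⟨d, hd⟩ := hω ⁅y, v⁆ v (hD v hv) hv
    -- D x = s • D v
    have hDx : ∀ x, σ x = -x → ∀ c : ℝ, ⁅x, u⁆ = c • y → ⁅y, x⁆ = (-(a⁻¹ * c)) • ⁅y, v⁆ := by
      intro x hx c hc
      obtain ⟨b, hb⟩ := hω v x hv hx
      have h := hJ u v x a b c ha hb hc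
      rw [hyu, smul_zero, add_zero] at h
      have h' : a • ⁅y, x⁆ = -(c • ⁅y, v⁆) := eq_neg_of_add_eq_zero_left h
      rw [← inv_smul_smul₀ ha0 ⁅y, x⁆, h']
      module
    have hDv : ⁅y, v⁆ = (a⁻¹ * d) • u := by
      rw [← sub_eq_zero]
      apply hrad
      · rw [map_sub, map_smul, hD v hv, hu]; module
      · intro x hx
        obtain ⟨c, hc⟩ := hω x u hx hu
        have h1 := hDx x hx c hc
        have h2 := hDsk x v hx hv
        rw [h1, smul_lie, hd] at h2
        rw [sub_lie, smul_lie, ← lie_skew, ← lie_skew u x, ← h2, hc]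
        module
    let I : LieIdeal ℝ L :=
      { carrier := {x | ∃ p q : ℝ, x = p • y + q • u}
        add_mem' := by
          rintro _ _ ⟨p, q, rfl⟩ ⟨p', q', rfl⟩
          exact ⟨p + p', q + q', by module⟩
        zero_mem' := ⟨0, 0, by simp⟩
        smul_mem' := by
          rintro c _ ⟨p, q, rfl⟩
          exact ⟨c * p, c * q, by module⟩
        lie_mem := by
          rintro z _ ⟨p, q, rfl⟩
          obtain ⟨t, x, hx, rfl⟩ := hdec z
          obtain ⟨c, hc⟩ := hω x u hx hu
          have h1 := hDx x hx c hc
          rw [hDv] at h1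
          refine ⟨q * c, p * (a⁻¹ * c) * (a⁻¹ * d), ?_⟩
          simp only [lie_add, add_lie, lie_smul, smul_lie, hyu, lie_self, hc]
          rw [← lie_skew x y, h1]
          module }
    rcases hsimp I with h | h
    · have : y ∈ I := ⟨1, 0, by simp⟩
      rw [h] at this
      exact hy (by simpa using this)
    · have : v ∈ I := by rw [h]; trivial
      obtain ⟨p, q, hpq⟩ := this
      apply huv
      rw [hpq, lie_add, lie_smul, lie_smul, lie_self, ← lie_skew, hyu]
      simp
  -- choose w
  have hw : ∃ w, σ w = -w ∧ ⁅w, ⁅y, w⁆⁆ ≠ 0 := by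
    by_contra hcon
    push Not at hcon
    have hz : ∀ w, σ w = -w → w = 0 := by
      intro w hw
      apply hinj w hw
      apply hrad _ (hD w hw)
      intro z hz
      have h1 := hcon (w + z) (by rw [map_add, hw, hz]; abel)
      simp only [lie_add, add_lie, hcon w hw, hcon z hz] at h1
      have h2 := hDsk w z hw hz
      rw [← lie_skew z] at h1
      have h3 : (2:ℝ) • ⁅⁅y, w⁆, z⁆ = 0 := by
        rw [two_smul, ← neg_eq_zero]
        nth_rewrite 1 [h2]
        rw [← h1]; abel
      exact (smul_eq_zero.1 h3).resolve_left (by norm_num)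
    apply LieAlgebra.IsSimple.non_abelian ℝ (L := L)
    refine ⟨fun a b => ?_⟩
    obtain ⟨t, v, hv, rfl⟩ := hdec a
    obtain ⟨t', v', hv', rfl⟩ := hdec b
    rw [hz v hv, hz v' hv']; simp
  obtain ⟨w, hw, hww⟩ := hw
  obtain ⟨c, hc⟩ := hω w ⁅y, w⁆ hw (hD w hw)
  have hc0 : c ≠ 0 := by rintro rfl; simp [hww] at hc
  have hspan : ∀ x, σ x = -x → ∀ a b : ℝ, ⁅⁅y, w⁆, x⁆ = a • y → ⁅x, w⁆ = b • y →
      c • x + a • w + b • ⁅y, w⁆ = 0 := by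
    intro x hx a b ha hb
    have h := hJ w ⁅y, w⁆ x c a b hc ha hb
    apply hinj
    · simp only [map_add, map_smul, hx, hw, hD w hw]; module
    · rw [← h]; simp
  have hsp2 : ∀ x, σ x = -x → ∀ a b : ℝ, ⁅⁅y, w⁆, x⁆ = a • y → ⁅x, w⁆ = b • y →
      x = (-(c⁻¹ * a)) • w + (-(c⁻¹ * b)) • ⁅y, w⁆ := by
    intro x hx a b ha hb
    have h := hspan x hx a b ha hb
    have h' : c • x = - (a • w + b • ⁅y, w⁆) := by
      rw [← sub_eq_zero, ← h]; abel
    rw [← inv_smul_smul₀ hc0 x, h']; module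
  have hDD : ∃ α : ℝ, ⁅y, ⁅y, w⁆⁆ = α • w := by
    obtain ⟨a, ha⟩ := hω ⁅y, w⁆ ⁅y, ⁅y, w⁆⁆ (hD w hw) (hD _ (hD w hw))
    have hb : ⁅⁅y, ⁅y, w⁆⁆, w⁆ = (0:ℝ) • y := by
      rw [hDsk _ _ (hD w hw) hw]; simp
    refine ⟨-(c⁻¹ * a), (hsp2 _ (hD _ (hD w hw)) a 0 ha hb).trans ?_⟩
    simp
  obtain ⟨α, hα⟩ := hDD
  refine ⟨w, c, α, hc0, ?_, hw, hc, hα, ?_⟩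
  · rintro rfl
    rw [zero_smul] at hα
    apply hww
    rw [hinj _ (hD w hw) hα]; simp
  · intro z
    obtain ⟨t, x, hx, rfl⟩ := hdec z
    obtain ⟨a, ha⟩ := hω ⁅y, w⁆ x (hD w hw) hx
    obtain ⟨b, hb⟩ := hω x w hx hw
    refine ⟨t, -(c⁻¹ * a), -(c⁻¹ * b), ?_⟩
    rw [add_assoc, ← hsp2 x hx a b ha hb]

theorem elliptic_lemma {L : Type*} [AddCommGroup L] [Module ℝ L] [FiniteDimensional ℝ L]
    (T : L →ₗ[ℝ] L) (α : ℝ) (hα : α < 0) (hT : ∀ x, T (T (T x)) = α • T x) :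
    Module.End.IsSemisimple (LinearMap.baseChange ℂ T) ∧
      ∀ μ : ℂ, Module.End.HasEigenvalue (LinearMap.baseChange ℂ T) μ → μ.re = 0 := by
  set S := LinearMap.baseChange ℂ T with hS
  have h3 : ∀ z, S (S (S z)) = (α : ℂ) • S z := by
    intro z
    induction z using TensorProduct.induction_on with
    | zero => simp
    | tmul a x =>
      simp only [hS, LinearMap.baseChange_tmul, hT]
      rw [TensorProduct.tmul_smul, ← algebraMap_smul ℂ α]
      rfl
    | add a b ha hb => simp only [map_add, smul_add, ha, hb]
  constructor
  · apply Module.End.isSemisimple_of_squarefree_aeval_eq_zero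
      (p := (Polynomial.X ^ 3 - Polynomial.C (α:ℂ) * Polynomial.X))
    · apply Polynomial.Separable.squarefree
      have hα' : (α : ℂ) ≠ 0 := by exact_mod_cast hα.ne
      have hβ : Polynomial.C ((α:ℂ)⁻¹) * Polynomial.C (α:ℂ) = 1 := by
        rw [← Polynomial.C_mul, inv_mul_cancel₀ hα', Polynomial.C_1]
      have hγ : 2 * Polynomial.C ((2:ℂ)⁻¹) = 1 := by
        have : (2 : Polynomial ℂ) = Polynomial.C (2:ℂ) := (map_ofNat Polynomial.C 2).symm
        rw [this, ← Polynomial.C_mul, mul_inv_cancel₀ (by norm_num), Polynomial.C_1]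
      have hd : Polynomial.derivative (Polynomial.X ^ 3 - Polynomial.C (α:ℂ) * Polynomial.X) =
          3 * Polynomial.X ^ 2 - Polynomial.C (α:ℂ) := by
        have : Polynomial.C (2:ℂ) = 2 := map_ofNat Polynomial.C 2
        simp [this]
        norm_num
      generalize Polynomial.C ((α:ℂ)⁻¹) = β at hβ
      generalize Polynomial.C ((2:ℂ)⁻¹) = γ at hγ
      refine ⟨-9 * γ * β ^ 2 * Polynomial.X, 3 * γ * β ^ 2 * Polynomial.X ^ 2 - β, ?_⟩
      rw [hd]
      linear_combination (1 + 6 * β * γ * Polynomial.X ^ 2) * hβ + 3 * β * Polynomial.X ^ 2 * hγ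
    · refine LinearMap.ext fun z => ?_
      simp [pow_succ, h3, Module.algebraMap_end_apply]
  · intro μ hμ
    obtain ⟨v, hv⟩ := hμ.exists_hasEigenvector
    have h1 := h3 v
    simp only [hv.apply_eq_smul, map_smul, smul_smul] at h1
    have h2 : μ * μ * μ = α * μ := smul_left_injective ℂ hv.2 h1
    by_cases h0 : μ = 0
    · simp [h0]
    have h4 : μ * μ = α := mul_right_cancel₀ h0 h2
    have hr := congrArg Complex.re h4
    have hi := congrArg Complex.im h4
    simp at hr hi
    by_contra hre
    have : μ.im = 0 := by
      have : μ.re * μ.im = 0 := by linarith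
      exact (mul_eq_zero.1 this).resolve_left hre
    rw [this] at hr
    nlinarith [mul_self_nonneg μ.re]

theorem iso_lemma {L : Type*} [LieRing L] [LieAlgebra ℝ L]
    (h e f : L) (h0 : h ≠ 0) (hhe : ⁅h, e⁆ = (2:ℝ) • e) (hhf : ⁅h, f⁆ = (-2:ℝ) • f)
    (hef : ⁅e, f⁆ = h) (hspan : ∀ x : L, ∃ p q r : ℝ, x = p • h + q • e + r • f) :
    Nonempty (L ≃ₗ⁅ℝ⁆ ↥(LieAlgebra.SpecialLinear.sl (Fin 2) ℝ)) := by
  have htr : ∀ A : LieAlgebra.SpecialLinear.sl (Fin 2) ℝ, A.1 1 1 = - A.1 0 0 := by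
    intro A
    have := A.2
    have h2 : Matrix.trace A.1 = 0 := this
    rw [Matrix.trace_fin_two] at h2
    linarith
  have heh : ⁅e, h⁆ = (-2:ℝ) • e := by rw [← lie_skew, hhe]; module
  have hfh : ⁅f, h⁆ = (2:ℝ) • f := by rw [← lie_skew, hhf]; module
  have hfe : ⁅f, e⁆ = (-1:ℝ) • h := by rw [← lie_skew, hef]; module
  let φ : LieAlgebra.SpecialLinear.sl (Fin 2) ℝ →ₗ⁅ℝ⁆ L :=
    { toFun := fun A => A.1 0 0 • h + A.1 0 1 • e + A.1 1 0 • f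
      map_add' := by intro A B; simp; module
      map_smul' := by intro c A; simp; module
      map_lie' := by
        intro A B
        have hA := htr A
        have hB := htr B
        simp only [LieSubalgebra.coe_bracket, Ring.lie_def, Matrix.sub_apply, Matrix.mul_apply,
          Fin.sum_univ_two, hA, hB, lie_add, add_lie, lie_smul, smul_lie, lie_self,
          hhe, hhf, hef, heh, hfh, hfe]
        module }
  have hinj : Function.Injective φ := by
    rw [injective_iff_map_eq_zero]
    intro A hA
    have hA : A.1 0 0 • h + A.1 0 1 • e + A.1 1 0 • f = 0 := hA
    have h1 := congrArg (fun x => ⁅h, x⁆) hA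
    simp only [lie_add, lie_smul, lie_self, hhe, hhf, lie_zero, smul_zero, zero_add] at h1
    have h2 := congrArg (fun x => ⁅h, x⁆) h1
    simp only [lie_add, lie_smul, lie_self, hhe, hhf, lie_zero, smul_zero, zero_add] at h2
    have hE : A.1 0 1 • e = 0 := by
      linear_combination (norm := module) (1 / 4 : ℝ) • h1 + (1 / 8 : ℝ) • h2
    have hF : A.1 1 0 • f = 0 := by
      linear_combination (norm := module) (-1 / 4 : ℝ) • h1 + (1 / 8 : ℝ) • h2
    have hH : A.1 0 0 • h = 0 := by
      rw [hE, hF] at hA; simpa using hA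
    have e0 : e ≠ 0 := by rintro rfl; apply h0; rw [← hef]; simp
    have f0 : f ≠ 0 := by rintro rfl; apply h0; rw [← hef]; simp
    have a1 := (smul_eq_zero.1 hE).resolve_right e0
    have a2 := (smul_eq_zero.1 hF).resolve_right f0
    have a3 := (smul_eq_zero.1 hH).resolve_right h0
    have a4 := htr A
    rw [a3, neg_zero] at a4
    apply Subtype.ext
    ext i j
    fin_cases i <;> fin_cases j
    · exact a3
    · exact a1
    · exact a2
    · exact a4
  have hsurj : Function.Surjective φ := by
    intro x
    obtain ⟨p, q, r, rfl⟩ := hspan x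
    refine ⟨⟨!![p, q; r, -p], ?_⟩, ?_⟩
    · have ht : Matrix.trace !![p, q; r, -p] = 0 := by simp [Matrix.trace_fin_two]
      exact ht
    · change (!![p, q; r, -p] : Matrix (Fin 2) (Fin 2) ℝ) 0 0 • h +
        (!![p, q; r, -p] : Matrix (Fin 2) (Fin 2) ℝ) 0 1 • e +
        (!![p, q; r, -p] : Matrix (Fin 2) (Fin 2) ℝ) 1 0 • f = _
      simp
  exact ⟨(LieEquiv.ofBijective φ ⟨hinj, hsurj⟩).symm⟩


/-- If `g₁` is a simple real Lie algebra with an involutive automorphism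
`σ₁` whose fixed-point algebra is `ℝ·y₀`, and `y₀` is not elliptic (i.e. `ad y₀` is
not semisimple with purely imaginary spectrum), then `g₁ ≅ sl₂(ℝ)`. -/
theorem stmt_16 {L : Type*} [LieRing L] [LieAlgebra ℝ L] [LieAlgebra.IsSimple ℝ L]
    [FiniteDimensional ℝ L]
    (σ₁ : L →ₗ⁅ℝ⁆ L) (hσ₁ : ∀ z : L, σ₁ (σ₁ z) = z)
    (y₀ : L) (hy₀ : y₀ ≠ 0)
    (hfix : {x : L | σ₁ x = x} = (Submodule.span ℝ {y₀} : Submodule ℝ L))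
    (hnotelliptic : ¬ (Module.End.IsSemisimple
        (LinearMap.baseChange ℂ ((LieAlgebra.ad ℝ L y₀ : L →ₗ[ℝ] L))) ∧
      ∀ μ : ℂ, Module.End.HasEigenvalue
        (LinearMap.baseChange ℂ ((LieAlgebra.ad ℝ L y₀ : L →ₗ[ℝ] L))) μ → μ.re = 0)) :
    Nonempty (L ≃ₗ⁅ℝ⁆ ↥(LieAlgebra.SpecialLinear.sl (Fin 2) ℝ)) := by
  have hfix' : ∀ x : L, σ₁ x = x ↔ ∃ c : ℝ, c • y₀ = x := by
    intro x
    have : x ∈ {x : L | σ₁ x = x} ↔ x ∈ (Submodule.span ℝ {y₀} : Submodule ℝ L) := by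
      rw [hfix]; rfl
    rw [Submodule.mem_span_singleton] at this
    exact this
  obtain ⟨w, c, α, hc, hα, hw, hwc, hDD, hspan⟩ := rank_one_lemma σ₁ hσ₁ y₀ hy₀ hfix'
  rcases lt_or_gt_of_ne hα with hneg | hpos
  · exfalso
    apply hnotelliptic
    apply elliptic_lemma _ α hneg
    intro x
    obtain ⟨p, q, r, rfl⟩ := hspan x
    simp only [LieAlgebra.ad_apply, lie_add, lie_smul, lie_self, hDD, lie_zero, smul_zero, zero_add]
    module
  · obtain ⟨l, hl, rfl⟩ : ∃ l : ℝ, 0 < l ∧ l * l = α :=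
      ⟨√α, Real.sqrt_pos.2 hpos, Real.mul_self_sqrt hpos.le⟩
    have hl0 := hl.ne'
    refine iso_lemma ((2 / l) • y₀) (⁅y₀, w⁆ + l • w) ((1 / (l * l * c)) • (⁅y₀, w⁆ - l • w))
      ?_ ?_ ?_ ?_ ?_
    · exact smul_ne_zero (by positivity) hy₀
    · simp only [smul_lie, lie_add, lie_smul, hDD]
      match_scalars <;> field_simp
    · simp only [smul_lie, lie_sub, lie_smul, hDD]
      match_scalars <;> field_simp
    · have h2 : ⁅⁅y₀, w⁆, w⁆ = (-c) • y₀ := by rw [← lie_skew, hwc]; module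
      simp only [smul_lie, lie_sub, add_lie, lie_smul, lie_self, hwc, h2]
      match_scalars; field_simp; ring
    · intro x
      obtain ⟨p, q, r, rfl⟩ := hspan x
      refine ⟨p * l / 2, (r + q / l) / 2, (r - q / l) / 2 * (l * l * c), ?_⟩
      match_scalars <;> field_simp <;> ring
end
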